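/- arXiv:1904.07228 — 2 statements merged into one kernel-verified Lean document; each statement's English description precedes it below -/
import Mathlib

section
/- Let n ≥ 5 and let F be the field of rational functions in the n indeterminates a₀, a₁, …, a_{n-1} over ℂ, i.e. the fraction field of ℂ[a₀,…,a_{n-1}]. Then no root (in a splitting field of P over F) of the generic monic polynomial P(X) = Xⁿ + a_{n-1}X^{n-1} + ⋯ + a₁X + a₀ is solvable by radicals over F: no root lies in the smallest intermediate field containing F that is closed under taking m-th roots for all m ≥ 1. -/
open Polynomial in
theorem aux_abstract {F K E : Type*} [Field F] [Field K] [Field E] [Algebra F K] [Algebra F E]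
    (n : ℕ) (hn : 5 ≤ n) (P : F[X]) (hP : P.Monic) (x : Fin n → K) (hx : Function.Injective x)
    (hprod : P.map (algebraMap F K) = ∏ i, (X - C (x i)))
    (hσ : ∀ σ : Equiv.Perm (Fin n), ∃ g : K ≃ₐ[F] K, ∀ i, g (x i) = x (σ i))
    (α : E) (hα : aeval α P = 0) : α ∉ solvableByRad F E := by
  classical
  intro hrad
  have hdeg : P.natDegree = n := by
    have h := congrArg natDegree hprod
    rw [natDegree_map, natDegree_finsetProd_X_sub_C_eq_card] at h
    simpa using h
  have hroot : ∀ i, aeval (x i) P = 0 := by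
    intro i
    rw [← eval_map_algebraMap, hprod, eval_prod]
    exact Finset.prod_eq_zero (Finset.mem_univ i) (by simp)
  let i0 : Fin n := ⟨0, by omega⟩
  have hint : IsIntegral F (x i0) := ⟨P, hP, hroot i0⟩
  set q := minpoly F (x i0) with hq
  have hqmon : q.Monic := minpoly.monic hint
  have hqroot : ∀ i, aeval (x i) q = 0 := by
    intro i
    obtain ⟨g, hg⟩ := hσ (Equiv.swap i0 i)
    have h1 : g (x i0) = x i := by rw [hg]; simp
    rw [← h1, aeval_algHom_apply g, hq, minpoly.aeval, map_zero]
  have hqdeg : n ≤ q.natDegree := by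
    have h1 : Finset.univ.image x ⊆ (q.map (algebraMap F K)).roots.toFinset := by
      intro y hy
      obtain ⟨i, -, rfl⟩ := Finset.mem_image.1 hy
      rw [Multiset.mem_toFinset, mem_roots (hqmon.map _).ne_zero, IsRoot.def,
        eval_map_algebraMap]
      exact hqroot i
    have h2 := Finset.card_le_card h1
    rw [Finset.card_image_of_injective _ hx, Finset.card_univ, Fintype.card_fin] at h2
    calc n ≤ _ := h2
      _ ≤ _ := Multiset.toFinset_card_le _
      _ ≤ _ := card_roots' _
      _ = _ := natDegree_map _
  have hqP : q = P := by
    refine Eq.symm (eq_of_monic_of_dvd_of_natDegree_le hqmon hP (minpoly.dvd F _ (hroot i0)) (by omega))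
  have hirr : Irreducible P := hqP ▸ minpoly.irreducible hint
  have hsolv : Group.IsSolvable P.Gal := isSolvable_gal_of_irreducible hrad hirr hα
  haveI : Fact ((P.map (algebraMap F K)).Splits) := ⟨by
    rw [hprod]; exact Splits.prod fun i _ => Splits.X_sub_C _⟩
  have hmem : ∀ i, x i ∈ P.rootSet K := fun i => mem_rootSet.2 ⟨hP.ne_zero, hroot i⟩
  let e : Fin n → P.rootSet K := fun i => ⟨x i, hmem i⟩
  have he : Function.Bijective e := by
    refine ⟨fun i j h => hx (congrArg Subtype.val h), ?_⟩
    rintro ⟨y, hy⟩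
    have h1 := (mem_rootSet.1 hy).2
    rw [← eval_map_algebraMap, hprod, eval_prod, Finset.prod_eq_zero_iff] at h1
    obtain ⟨i, -, hi⟩ := h1
    refine ⟨i, Subtype.ext ?_⟩
    simp only [eval_sub, eval_X, eval_C, sub_eq_zero] at hi
    exact hi.symm
  let e' := Equiv.ofBijective e he
  have hsurj : Function.Surjective (Gal.galActionHom P K) := by
    intro π
    obtain ⟨g, hg⟩ := hσ ((e'.trans π).trans e'.symm)
    refine ⟨Gal.restrict P K g, ?_⟩
    ext y
    obtain ⟨i, rfl⟩ := e'.surjective y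
    rw [Gal.galActionHom_restrict]
    change g (x i) = _
    rw [hg]
    change (e' (e'.symm (π (e' i))) : K) = _
    rw [Equiv.apply_symm_apply]
  refine Equiv.Perm.not_isSolvable (P.rootSet K) ?_ (Group.isSolvable_of_surjective hsurj)
  haveI : Fintype (P.rootSet K) := Fintype.ofEquiv _ e'
  rw [Cardinal.mk_fintype, ← Fintype.card_congr e', Fintype.card_fin]
  exact_mod_cast hn

theorem aux_generic {F K E : Type*} [Field F] [Field K] [Field E] [Algebra F E]
    (n : ℕ) (hn : 5 ≤ n)
    [Algebra (MvPolynomial (Fin n) ℂ) F] [IsFractionRing (MvPolynomial (Fin n) ℂ) F]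
    [Algebra (MvPolynomial (Fin n) ℂ) K] [IsFractionRing (MvPolynomial (Fin n) ℂ) K]
    (α : E) (hα : Polynomial.aeval α (Polynomial.X ^ n + ∑ i : Fin n,
      Polynomial.C (algebraMap (MvPolynomial (Fin n) ℂ) F (MvPolynomial.X i)) *
        Polynomial.X ^ (i : ℕ)) = 0) : α ∉ solvableByRad F E := by
  classical
  let φ : MvPolynomial (Fin n) ℂ →ₐ[ℂ] MvPolynomial (Fin n) ℂ :=
    (MvPolynomial.aeval (fun i : Fin n ↦ MvPolynomial.esymm (Fin n) ℂ (i + 1))).comp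
      (MvPolynomial.rename Fin.rev)
  have hφX : ∀ i : Fin n, φ (MvPolynomial.X i) = MvPolynomial.esymm (Fin n) ℂ (n - i) := by
    intro i
    simp only [φ, AlgHom.comp_apply, MvPolynomial.rename_X, MvPolynomial.aeval_X, Fin.val_rev]
    congr 1
    omega
  have hφ : Function.Injective φ := by
    have h1 : Function.Injective (MvPolynomial.aeval (R := ℂ)
        (fun i : Fin n ↦ MvPolynomial.esymm (Fin n) ℂ (i + 1))) := by
      intro p q h
      apply MvPolynomial.esymmAlgHom_injective (σ := Fin n) ℂ (n := n) (by simp)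
      apply Subtype.ext
      rw [MvPolynomial.esymmAlgHom_apply, MvPolynomial.esymmAlgHom_apply, h]
    exact h1.comp (MvPolynomial.rename_injective _ Fin.rev_injective)
  let ι := algebraMap (MvPolynomial (Fin n) ℂ) K
  have hι : Function.Injective ι := IsFractionRing.injective _ _
  let ψ : F →+* K := IsFractionRing.lift (A := MvPolynomial (Fin n) ℂ)
    (g := ι.comp φ.toRingHom) (hι.comp hφ)
  have hψ : ∀ p, ψ (algebraMap _ F p) = ι (φ p) := fun p => IsFractionRing.lift_algebraMap _ p
  letI : Algebra F K := ψ.toAlgebra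
  refine aux_abstract n hn _ ?_ (fun i => - ι (MvPolynomial.X i)) ?_ ?_ ?_ α hα
  · apply Polynomial.monic_X_pow_add
    rw [Polynomial.degree_lt_iff_coeff_zero]
    intro m hm
    rw [Polynomial.finsetSum_coeff]
    refine Finset.sum_eq_zero fun i _ => ?_
    rw [Polynomial.coeff_C_mul_X_pow, if_neg]
    omega
  · intro i j h
    exact MvPolynomial.X_injective (hι (neg_injective h))
  · have h := congrArg (Polynomial.map ι) (MvPolynomial.prod_C_add_X_eq_sum_esymm ℂ (Fin n))
    rw [Polynomial.map_prod, Fintype.card_fin, Finset.sum_range_succ', Polynomial.map_add] at h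
    simp only [Polynomial.map_add, Polynomial.map_X, Polynomial.map_C] at h
    simp only [map_neg, sub_neg_eq_add]
    refine Eq.trans ?_ h.symm
    change Polynomial.map ψ _ = _
    rw [add_comm]
    simp only [Polynomial.map_add, Polynomial.map_sum, Polynomial.map_mul, Polynomial.map_C,
      Polynomial.map_pow, Polynomial.map_X, hψ, hφX, MvPolynomial.esymm_zero, map_one, one_mul,
      Nat.sub_zero]
    congr 1
    rw [Fin.sum_univ_eq_sum_range (fun i => Polynomial.C (ι (MvPolynomial.esymm (Fin n) ℂ (n - i)))
      * Polynomial.X ^ i), ← Finset.sum_range_reflect]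
    refine Finset.sum_congr rfl fun j hj => ?_
    rw [Finset.mem_range] at hj
    rw [show n - (n - 1 - j) = j + 1 by omega, show n - 1 - j = n - (j + 1) by omega]
  · intro σ
    let r : MvPolynomial (Fin n) ℂ ≃+* MvPolynomial (Fin n) ℂ :=
      (MvPolynomial.renameEquiv ℂ σ).toRingEquiv
    let g : K ≃+* K := IsFractionRing.ringEquivOfRingEquiv r
    have hg : ∀ p, g (ι p) = ι (r p) := fun p => IsFractionRing.ringEquivOfRingEquiv_algebraMap r p
    have hr : ∀ p, r (φ p) = φ p := by
      intro p
      have : (MvPolynomial.rename σ).comp φ = φ := by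
        apply MvPolynomial.algHom_ext
        intro i
        rw [AlgHom.comp_apply, hφX, MvPolynomial.rename_esymm]
      exact DFunLike.congr_fun this p
    have hcomm : (g : K →+* K).comp ψ = ψ := by
      apply IsFractionRing.ringHom_ext (A := MvPolynomial (Fin n) ℂ)
      intro p
      simp only [RingHom.comp_apply, hψ, RingHom.coe_coe, hg, hr]
    refine ⟨AlgEquiv.ofRingEquiv (f := g) fun a => RingHom.congr_fun hcomm a, fun i => ?_⟩
    change g (- ι _) = _
    rw [map_neg, hg]
    congr 2
    exact MvPolynomial.rename_X _ _

/-- Abel–Ruffini for the universal equation: For `n ≥ 5`, no root, in a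
splitting field, of the generic monic polynomial
`P(X) = Xⁿ + a_{n-1} X^{n-1} + ⋯ + a₁ X + a₀` over `F = ℂ(a₀,…,a_{n-1})` is solvable by
radicals over `F`: no root lies in the smallest intermediate field containing `F` that is
closed under taking `m`-th roots for all `m ≥ 1`. -/
theorem generic_monic_polynomial_not_solvable_by_radicals (n : ℕ) (hn : 5 ≤ n) :
    ∀ α ∈ (Polynomial.X ^ n +
        ∑ i : Fin n,
          Polynomial.C
            (algebraMap (MvPolynomial (Fin n) ℂ) (FractionRing (MvPolynomial (Fin n) ℂ))
              (MvPolynomial.X i)) *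
            Polynomial.X ^ (i : ℕ)).rootSet
        (Polynomial.X ^ n +
          ∑ i : Fin n,
            Polynomial.C
              (algebraMap (MvPolynomial (Fin n) ℂ) (FractionRing (MvPolynomial (Fin n) ℂ))
                (MvPolynomial.X i)) *
              Polynomial.X ^ (i : ℕ)).SplittingField,
      α ∉ solvableByRad (FractionRing (MvPolynomial (Fin n) ℂ))
        (Polynomial.X ^ n +
          ∑ i : Fin n,
            Polynomial.C
              (algebraMap (MvPolynomial (Fin n) ℂ) (FractionRing (MvPolynomial (Fin n) ℂ))
                (MvPolynomial.X i)) *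
              Polynomial.X ^ (i : ℕ)).SplittingField := by
  intro α hα
  exact aux_generic (K := FractionRing (MvPolynomial (Fin n) ℂ)) n hn α
    (Polynomial.mem_rootSet.1 hα).2
end

section
/- Let U ⊆ ℂⁿ be a nonempty open connected set and let f : ℂⁿ → ℂ be analytic at every point of U and not identically zero on U. Then the complement in U of the zero set of f, namely {z ∈ U : f(z) ≠ 0}, is a connected set. -/
open Set Filter Topology

theorem aux_top {X : Type*} [TopologicalSpace X] {U S : Set X} (hU : IsPreconnected U)
    (hSU : S ⊆ U) (hd : U ⊆ closure S)
    (hloc : ∀ x ∈ U, ∃ N, IsOpen N ∧ x ∈ N ∧ IsPreconnected (S ∩ N)) : IsPreconnected S := by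
  intro u v hu hv huv hSu hSv
  by_contra hcon
  have hemp : S ∩ (u ∩ v) = ∅ := not_nonempty_iff_eq_empty.mp hcon
  have key : ∀ w : Set X, IsOpen {x | ∃ N, IsOpen N ∧ x ∈ N ∧ S ∩ N ⊆ w} := by
    intro w
    rw [isOpen_iff_forall_mem_open]
    rintro x ⟨N, hN, hx, hs⟩
    exact ⟨N, fun y hy => ⟨N, hN, hy, hs⟩, hN, hx⟩
  obtain ⟨x, hxU, ⟨N, hN, hxN, hs⟩, ⟨N', hN', hxN', hs'⟩⟩ := hU _ _ (key u) (key v) (by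
      intro x hx
      obtain ⟨N, hN, hxN, hp⟩ := hloc x hx
      rcases isPreconnected_iff_subset_of_disjoint.1 hp u v hu hv
        (fun y hy => huv hy.1) (by
          apply subset_empty_iff.1
          rw [← hemp]
          exact fun y hy => ⟨hy.1.1, hy.2⟩) with h | h
      · exact Or.inl ⟨N, hN, hxN, h⟩
      · exact Or.inr ⟨N, hN, hxN, h⟩)
    (by obtain ⟨a, ha, hau⟩ := hSu
        exact ⟨a, hSU ha, u, hu, hau, inter_subset_right⟩)
    (by obtain ⟨a, ha, hau⟩ := hSv
        exact ⟨a, hSU ha, v, hv, hau, inter_subset_right⟩)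
  obtain ⟨y, hy, hyS⟩ := mem_closure_iff.1 (hd hxU) (N ∩ N') (hN.inter hN') ⟨hxN, hxN'⟩
  exact hcon ⟨y, hyS, hs ⟨hyS, hy.1⟩, hs' ⟨hyS, hy.2⟩⟩

theorem aux_punct (c : ℂ) {r : ℝ} (hr : 0 < r) :
    IsPreconnected (Metric.ball c r \ {c}) := by
  have h : Metric.ball c r \ {c} = (fun z => c + Complex.exp z) '' {z : ℂ | z.re < Real.log r} := by
    ext w
    constructor
    · rintro ⟨h1, h2⟩
      have h3 : w - c ≠ 0 := sub_ne_zero.2 h2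
      refine ⟨Complex.log (w - c), ?_, by simp [Complex.exp_log h3]⟩
      simp only [mem_ofPred_eq, Complex.log_re]
      exact Real.log_lt_log (norm_pos_iff.2 h3) (by simpa [dist_eq_norm] using h1)
    · rintro ⟨z, hz, rfl⟩
      refine ⟨?_, by simp⟩
      simpa [dist_eq_norm, Complex.norm_exp] using (Real.lt_log_iff_exp_lt hr).1 hz
  rw [h]
  exact (convex_halfSpace_re_lt _).isPreconnected.image _ (by fun_prop)

theorem aux_dense {E : Type*} [NormedAddCommGroup E] [NormedSpace ℂ E] {U : Set E}
    (hUo : IsOpen U) (hUc : IsPreconnected U) {f : E → ℂ}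
    (hf : AnalyticOnNhd ℂ f U) (hne : ¬ ∀ z ∈ U, f z = 0) : U ⊆ closure {z ∈ U | f z ≠ 0} := by
  intro x hx
  by_contra hcon
  apply hne
  apply hf.eqOn_zero_of_preconnected_of_eventuallyEq_zero hUc hx
  filter_upwards [hUo.mem_nhds hx, isClosed_closure.isOpen_compl.mem_nhds hcon] with y hy hy'
  by_contra h
  exact hy' (subset_closure ⟨hy, h⟩)

theorem aux_one {V : Set ℂ} (hVo : IsOpen V) (hVc : IsPreconnected V) {g : ℂ → ℂ}
    (hg : AnalyticOnNhd ℂ g V) (hne : ¬ ∀ z ∈ V, g z = 0) :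
    IsPreconnected {z ∈ V | g z ≠ 0} := by
  refine aux_top hVc (fun z hz => hz.1) (aux_dense hVo hVc hg hne) fun x hx => ?_
  have h1 : ∀ᶠ z in 𝓝[≠] x, g z ≠ 0 := by
    by_contra h
    apply hne
    apply hg.eqOn_zero_of_preconnected_of_frequently_eq_zero hVc hx
    exact fun h' => h h'
  rw [eventually_nhdsWithin_iff] at h1
  obtain ⟨r, hr, hb⟩ := Metric.eventually_nhds_iff_ball.1 (h1.and (hVo.mem_nhds hx))
  refine ⟨Metric.ball x r, Metric.isOpen_ball, Metric.mem_ball_self hr, ?_⟩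
  by_cases h0 : g x = 0
  · convert! aux_punct x hr using 1
    ext z
    constructor
    · rintro ⟨⟨h2, h3⟩, h4⟩
      exact ⟨h4, fun h => h3 (by rw [mem_singleton_iff.1 h, h0])⟩
    · rintro ⟨h2, h3⟩
      exact ⟨⟨(hb z h2).2, (hb z h2).1 h3⟩, h2⟩
  · convert! (convex_ball x r).isPreconnected using 1
    refine inter_eq_right.2 fun z hz => ⟨(hb z hz).2, ?_⟩
    by_cases hzx : z = x
    · rwa [hzx]
    · exact (hb z hz).1 hzx

theorem aux_ball {E : Type*} [NormedAddCommGroup E] [NormedSpace ℂ E] {B : Set E}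
    (hBo : IsOpen B) (hBc : Convex ℝ B) {f : E → ℂ} (hf : AnalyticOnNhd ℂ f B) :
    IsPreconnected {z ∈ B | f z ≠ 0} := by
  apply isPreconnected_of_forall_pair
  rintro a ⟨haB, ha⟩ b ⟨hbB, hb⟩
  let L : ℂ → E := fun t => a + t • (b - a)
  have hLc : Continuous L := by fun_prop
  have hLa : ∀ t, AnalyticAt ℂ L t := fun t =>
    analyticAt_const.add (analyticAt_id.smul analyticAt_const)
  have hconv : Convex ℝ (L ⁻¹' B) := by
    intro s hs t ht p q hp hq hpq
    have h := hBc hs ht hp hq hpq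
    have e : L (p • s + q • t) = p • L s + q • L t := by
      simp only [L, smul_add, add_smul, smul_assoc]
      have : a = p • a + q • a := by rw [← add_smul, hpq, one_smul]
      nth_rewrite 1 [this]
      abel
    rw [mem_preimage, e]
    exact h
  have h0 : L 0 = a := by simp [L]
  have h1 : L 1 = b := by simp [L]
  have hp := aux_one (g := f ∘ L) (hBo.preimage hLc) hconv.isPreconnected
    (fun t ht => (hf _ ht).comp (hLa t))
    (fun h => ha (by simpa [h0] using h 0 (by simpa [h0] using haB)))
  refine ⟨L '' {z ∈ L ⁻¹' B | (f ∘ L) z ≠ 0}, ?_, ⟨0, ⟨?_, ?_⟩, h0⟩, ⟨1, ⟨?_, ?_⟩, h1⟩, hp.image L hLc.continuousOn⟩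
  · rintro _ ⟨t, ht, rfl⟩
    exact ht
  · simpa [h0] using haB
  · simpa [h0] using ha
  · simpa [h1] using hbB
  · simpa [h1] using hb

/-- If `f : ℂⁿ → ℂ` is analytic on a nonempty open connected set `U` and not
identically zero on `U`, then the complement in `U` of the zero set of `f` is connected. -/
theorem complement_of_analytic_zero_set_connected (n : ℕ) (U : Set (Fin n → ℂ))
    (hUo : IsOpen U) (hUc : IsConnected U) (f : (Fin n → ℂ) → ℂ)
    (hf : AnalyticOnNhd ℂ f U) (hne : ¬ ∀ z ∈ U, f z = 0) :
    IsConnected {z ∈ U | f z ≠ 0} := by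
  refine ⟨?_, ?_⟩
  · push Not at hne
    exact hne
  refine aux_top hUc.isPreconnected (fun z hz => hz.1)
    (aux_dense hUo hUc.isPreconnected hf hne) fun x hx => ?_
  obtain ⟨r, hr, hb⟩ := Metric.isOpen_iff.1 hUo x hx
  refine ⟨Metric.ball x r, Metric.isOpen_ball, Metric.mem_ball_self hr, ?_⟩
  convert! aux_ball Metric.isOpen_ball (convex_ball x r) (hf.mono hb) using 1
  ext z
  exact ⟨fun h => ⟨h.2, h.1.2⟩, fun h => ⟨⟨hb h.1, h.2⟩, h.1⟩⟩
end
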